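/- arXiv:1601.02085 — 8 statements merged into one kernel-verified Lean document; each statement's English description precedes it below -/
import Mathlib

section
/- For all real numbers y and z, the series ∑_{α=1}^∞ |φ_α(y) − φ_α(z)|² / λ_α, i.e. ∑_{α=1}^∞ 2(sin(απy) − sin(απz))² / (απ)², converges and is bounded above by (8/π)|y − z|. -/
open Real

theorem hasSum_one_sub_cos_div_sq {d : ℝ} (hd₀ : 0 ≤ d) (hd₂ : d ≤ 2) :
    HasSum (fun n : ℕ => 1 / (n : ℝ) ^ 2 * (1 - cos (n * π * d)))
      (π ^ 2 * (d / 2 - d ^ 2 / 4)) := by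
  have hcos := hasSum_one_div_nat_pow_mul_cos one_ne_zero (x := d / 2)
    ⟨by linarith, by linarith⟩
  convert! hasSum_zeta_two.sub hcos using 1
  · funext n
    rw [show 2 * π * n * (d / 2) = n * π * d by ring]
    ring
  · simp [Polynomial.bernoulli_def, Finset.sum_range_succ, Nat.choose, bernoulli_two,
      bernoulli_one, Nat.factorial]
    ring

theorem sq_sin_sub_sin_le (a b : ℝ) : (sin a - sin b) ^ 2 ≤ 2 * (1 - cos (a - b)) := by
  have ha := sin_sq_add_cos_sq a
  have hb := sin_sq_add_cos_sq b
  rw [cos_sub]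
  nlinarith [sq_nonneg (cos a - cos b)]

theorem summable_and_tsum_pnat_le_of_hasSum_nat {f : ℕ+ → ℝ} {g : ℕ → ℝ} {s c : ℝ}
    (hg : HasSum g s) (hg₀ : g 0 = 0) (hf : ∀ n, 0 ≤ f n) (hfg : ∀ n : ℕ+, f n ≤ g n)
    (hs : s ≤ c) : Summable f ∧ ∑' n, f n ≤ c := by
  have hg' : HasSum (fun n : ℕ+ => g n) s := by
    refine (PNat.coe_injective.hasSum_iff fun n hn => ?_).2 hg
    rcases Nat.eq_zero_or_pos n with rfl | h
    · exact hg₀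
    · exact (hn ⟨⟨n, h⟩, rfl⟩).elim
  have hfs : Summable f := hg'.summable.of_nonneg_of_le hf hfg
  exact ⟨hfs, (hasSum_le hfg hfs.hasSum hg').trans hs⟩

theorem stmt_0 (y z : ℝ) :
    Summable (fun α : ℕ+ =>
      2 * (Real.sin ((α : ℝ) * Real.pi * y) - Real.sin ((α : ℝ) * Real.pi * z)) ^ 2
        / ((α : ℝ) * Real.pi) ^ 2) ∧
    ∑' α : ℕ+,
      2 * (Real.sin ((α : ℝ) * Real.pi * y) - Real.sin ((α : ℝ) * Real.pi * z)) ^ 2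
        / ((α : ℝ) * Real.pi) ^ 2 ≤ (8 / Real.pi) * |y - z| := by
  have hπ := pi_pos
  have hd₀ := abs_nonneg (y - z)
  have hconst : 2 * |y - z| ≤ 8 / π * |y - z| := by
    gcongr
    rw [le_div_iff₀ hπ]
    linarith [pi_le_four]
  have hterm : ∀ n : ℕ+, (sin (n * π * y) - sin (n * π * z)) ^ 2
      ≤ 2 * (1 - cos (n * π * |y - z|)) := fun n => by
    have h := sq_sin_sub_sin_le (n * π * y) (n * π * z)
    have hnπ : 0 ≤ (n : ℝ) * π := by positivity
    rwa [← mul_sub, ← cos_abs, abs_mul, abs_of_nonneg hnπ] at h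
  rcases le_total |y - z| 2 with hd₂ | hd₂
  · refine summable_and_tsum_pnat_le_of_hasSum_nat
      ((hasSum_one_sub_cos_div_sq hd₀ hd₂).mul_left (4 / π ^ 2)) (by simp)
      (fun n => by positivity) (fun n => ?_) (le_trans ?_ hconst)
    · calc _ ≤ 2 * (2 * (1 - cos (n * π * |y - z|))) / (n * π) ^ 2 := by
            gcongr
            exact hterm n
        _ = _ := by
            field_simp
            ring
    · field_simp
      nlinarith
  · refine summable_and_tsum_pnat_le_of_hasSum_nat
      (hasSum_zeta_two.mul_left (8 / π ^ 2)) (by simp)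
      (fun n => by positivity) (fun n => ?_) (le_trans ?_ hconst)
    · calc _ ≤ 2 * 4 / ((n : ℝ) * π) ^ 2 := by
            gcongr
            linarith [hterm n, neg_one_le_cos (n * π * |y - z|)]
        _ = _ := by
            field_simp
            ring
    · rw [show 8 / π ^ 2 * (π ^ 2 / 6) = 4 / 3 by field_simp; norm_num]
      linarith
end

section
/- For every κ with 1/2 < κ < 3/2 there exists a constant C = C(κ) > 0 such that for all real numbers y and z, ∑_{α=1}^∞ |ψ_α(y) − ψ_α(z)|² / λ_α^κ, i.e. ∑_{α=1}^∞ 2(cos(απy) − cos(απz))² / (απ)^{2κ}, converges and is at most C|y − z|^{2κ−1}. -/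
open Real

open MeasureTheory Set in
lemma integrableOn_min_sq_mul_rpow {s : ℝ} (h₁ : 1 < s) (h₃ : s < 3) :
    IntegrableOn (fun u : ℝ => min 4 (u ^ 2) * u ^ (-s)) (Ioi 0) := by
  have hm : Measurable (fun u : ℝ => min 4 (u ^ 2) * u ^ (-s)) := by fun_prop
  rw [← Ioc_union_Ioi_eq_Ioi (zero_le_one (α := ℝ))]
  refine IntegrableOn.union ?_ ?_
  · have hi : IntegrableOn (fun u : ℝ => u ^ (2 - s)) (Ioc 0 1) := by
      rw [← intervalIntegrable_iff_integrableOn_Ioc_of_le zero_le_one]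
      exact intervalIntegral.intervalIntegrable_rpow' (by linarith)
    refine Integrable.mono' hi hm.aestronglyMeasurable ?_
    filter_upwards [ae_restrict_mem measurableSet_Ioc] with u hu
    have hp : (0 : ℝ) < u ^ (-s) := rpow_pos_of_pos hu.1 _
    rw [norm_of_nonneg (by positivity), sub_eq_add_neg, rpow_add hu.1, rpow_two]
    gcongr
    exact min_le_right _ _
  · have hi : IntegrableOn (fun u : ℝ => 4 * u ^ (-s)) (Ioi 1) :=
      (integrableOn_Ioi_rpow_of_lt (by linarith) one_pos).const_mul 4
    refine Integrable.mono' hi hm.aestronglyMeasurable ?_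
    filter_upwards [ae_restrict_mem measurableSet_Ioi] with u hu
    have hp : (0 : ℝ) < u ^ (-s) := rpow_pos_of_pos (one_pos.trans hu) _
    rw [norm_of_nonneg (by positivity)]
    gcongr
    exact min_le_left _ _

lemma sq_cos_sub_cos_le_min (a b : ℝ) : (cos a - cos b) ^ 2 ≤ min 4 ((a - b) ^ 2) := by
  refine le_min ?_ (sq_le_sq.2 (abs_cos_sub_cos_le a b))
  nlinarith [neg_one_le_cos a, cos_le_one a, neg_one_le_cos b, cos_le_one b]

/-- Comparison of a single term with an integral over `[n h π, (n + 1) h π]`. -/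
lemma term_le_integral {s h m : ℝ} (h₁ : 1 < s) (h₃ : s < 3) (hh : 0 < h) (hm : 1 ≤ m) :
    min 4 ((m * π * h) ^ 2) / (m * π) ^ s ≤
      2 ^ s * h ^ (s - 1) *
        ∫ u in (m * (π * h))..((m + 1) * (π * h)), min 4 (u ^ 2) * u ^ (-s) := by
  have hπ := pi_gt_three
  have hp : 0 < π * h := by positivity
  have hm0 : 0 < m := by linarith
  have hle : m * (π * h) ≤ (m + 1) * (π * h) := by nlinarith
  have hI : IntervalIntegrable (fun u : ℝ => min 4 (u ^ 2) * u ^ (-s)) MeasureTheory.volume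
      (m * (π * h)) ((m + 1) * (π * h)) := by
    rw [intervalIntegrable_iff_integrableOn_Ioc_of_le hle]
    refine (integrableOn_min_sq_mul_rpow h₁ h₃).mono_set fun u hu => ?_
    exact lt_of_le_of_lt (by positivity) hu.1
  set T := min 4 ((m * π * h) ^ 2) / (m * π) ^ s with hT
  have hT0 : 0 ≤ T := by positivity
  have hpt : ∀ u ∈ Set.Icc (m * (π * h)) ((m + 1) * (π * h)),
      T ≤ 2 ^ s * h ^ s * (min 4 (u ^ 2) * u ^ (-s)) := by
    intro u hu
    have hu0 : 0 < u := lt_of_lt_of_le (by positivity) hu.1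
    have hu2 : u ≤ 2 * h * (m * π) := by nlinarith [hu.2]
    have hpow : u ^ s ≤ 2 ^ s * h ^ s * (m * π) ^ s := by
      rw [← mul_rpow (by positivity) (by positivity), ← mul_rpow (by positivity) (by positivity)]
      exact rpow_le_rpow hu0.le hu2 (by linarith)
    have hmin : min 4 ((m * π * h) ^ 2) ≤ min 4 (u ^ 2) := by
      gcongr
      linarith [hu.1]
    have hus : 0 < u ^ s := rpow_pos_of_pos hu0 _
    rw [hT, rpow_neg hu0.le, div_le_iff₀ (by positivity)]
    calc min 4 ((m * π * h) ^ 2) ≤ min 4 (u ^ 2) := hmin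
      _ = min 4 (u ^ 2) * (u ^ s)⁻¹ * u ^ s := by field_simp
      _ ≤ min 4 (u ^ 2) * (u ^ s)⁻¹ * (2 ^ s * h ^ s * (m * π) ^ s) := by gcongr
      _ = _ := by ring
  have key := intervalIntegral.integral_mono_on hle
    (intervalIntegrable_const (c := T)) (hI.const_mul (2 ^ s * h ^ s)) hpt
  rw [intervalIntegral.integral_const, intervalIntegral.integral_const_mul, smul_eq_mul] at key
  have hs : h ^ s = h ^ (s - 1) * h := by
    rw [← rpow_add_one hh.ne']; congr 1; ring
  rw [hs] at key
  set I := ∫ u in (m * (π * h))..((m + 1) * (π * h)), min 4 (u ^ 2) * u ^ (-s)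
  have h2 : h * (π * T) ≤ h * (2 ^ s * h ^ (s - 1) * I) := by linarith
  have h3 := le_of_mul_le_mul_left h2 hh
  nlinarith

lemma sum_range_le_integral {s h : ℝ} (h₁ : 1 < s) (h₃ : s < 3) (hh : 0 < h) (N : ℕ) :
    ∑ n ∈ Finset.range N, min 4 ((((n + 1 : ℕ) : ℝ) * π * h) ^ 2) / (((n + 1 : ℕ) : ℝ) * π) ^ s ≤
      2 ^ s * h ^ (s - 1) * ∫ u in Set.Ioi (0 : ℝ), min 4 (u ^ 2) * u ^ (-s) := by
  have hp : 0 < π * h := by positivity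
  have hG := integrableOn_min_sq_mul_rpow h₁ h₃
  have hsub : ∀ a b : ℝ, 0 ≤ a → Set.Ioc a b ⊆ Set.Ioi 0 := fun a b ha u hu =>
    lt_of_le_of_lt ha hu.1
  have hadj := intervalIntegral.sum_integral_adjacent_intervals
    (f := fun u : ℝ => min 4 (u ^ 2) * u ^ (-s)) (μ := MeasureTheory.volume)
    (a := fun n : ℕ => ((n + 1 : ℕ) : ℝ) * (π * h)) (n := N) (fun k _ => by
      rw [intervalIntegrable_iff_integrableOn_Ioc_of_le (by gcongr; omega)]
      exact hG.mono_set (hsub _ _ (by positivity)))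
  calc _ ≤ ∑ n ∈ Finset.range N, 2 ^ s * h ^ (s - 1) *
        ∫ u in (((n + 1 : ℕ) : ℝ) * (π * h))..(((n + 1 + 1 : ℕ) : ℝ) * (π * h)),
          min 4 (u ^ 2) * u ^ (-s) := by
        refine Finset.sum_le_sum fun n _ => ?_
        rw [Nat.cast_succ (n + 1)]
        exact term_le_integral h₁ h₃ hh (by simp)
    _ ≤ _ := by
        rw [← Finset.mul_sum, hadj]
        gcongr
        rw [intervalIntegral.integral_of_le (by gcongr; omega)]
        refine MeasureTheory.setIntegral_mono_set hG ?_ (hsub _ _ (by positivity)).eventuallyLE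
        filter_upwards [MeasureTheory.ae_restrict_mem measurableSet_Ioi] with u hu
        have : (0 : ℝ) < u ^ (-s) := rpow_pos_of_pos hu _
        simp only [Pi.zero_apply]
        positivity

theorem stmt_3 (κ : ℝ) (hκ₁ : 1 / 2 < κ) (hκ₂ : κ < 3 / 2) :
    ∃ C : ℝ, 0 < C ∧ ∀ y z : ℝ,
      Summable (fun α : ℕ+ =>
        2 * (Real.cos ((α : ℝ) * Real.pi * y) - Real.cos ((α : ℝ) * Real.pi * z)) ^ 2
          / ((α : ℝ) * Real.pi) ^ (2 * κ)) ∧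
      ∑' α : ℕ+,
        2 * (Real.cos ((α : ℝ) * Real.pi * y) - Real.cos ((α : ℝ) * Real.pi * z)) ^ 2
          / ((α : ℝ) * Real.pi) ^ (2 * κ) ≤ C * |y - z| ^ (2 * κ - 1) := by
  have h₁ : 1 < 2 * κ := by linarith
  have h₃ : 2 * κ < 3 := by linarith
  set J := ∫ u in Set.Ioi (0 : ℝ), min 4 (u ^ 2) * u ^ (-(2 * κ)) with hJ
  have hJ0 : 0 ≤ J := MeasureTheory.setIntegral_nonneg measurableSet_Ioi fun u hu => by
    have : (0 : ℝ) < u ^ (-(2 * κ)) := rpow_pos_of_pos hu _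
    positivity
  refine ⟨2 * 2 ^ (2 * κ) * J + 1, by positivity, fun y z => ?_⟩
  rcases eq_or_ne y z with rfl | hyz
  · simp only [sub_self, ne_eq, OfNat.ofNat_ne_zero, not_false_eq_true, zero_pow, mul_zero,
      zero_div, tsum_zero, abs_zero]
    exact ⟨summable_zero, by positivity⟩
  have hh : 0 < |y - z| := abs_pos.2 (sub_ne_zero.2 hyz)
  set f : ℕ → ℝ := fun n => 2 * (cos ((n : ℝ) * π * y) - cos ((n : ℝ) * π * z)) ^ 2
    / ((n : ℝ) * π) ^ (2 * κ) with hf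
  have hf0 : ∀ n, 0 ≤ f (n + 1) := fun n => by positivity
  have hbound : ∀ N, ∑ n ∈ Finset.range N, f (n + 1) ≤
      (2 * 2 ^ (2 * κ) * J + 1) * |y - z| ^ (2 * κ - 1) := by
    intro N
    have hsum := sum_range_le_integral h₁ h₃ hh N
    have hterm : ∑ n ∈ Finset.range N, f (n + 1) ≤ ∑ n ∈ Finset.range N,
        2 * (min 4 ((((n + 1 : ℕ) : ℝ) * π * |y - z|) ^ 2) /
          (((n + 1 : ℕ) : ℝ) * π) ^ (2 * κ)) := by
      refine Finset.sum_le_sum fun n _ => ?_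
      rw [hf, ← mul_div_assoc]
      have hc := sq_cos_sub_cos_le_min (((n + 1 : ℕ) : ℝ) * π * y) (((n + 1 : ℕ) : ℝ) * π * z)
      rw [← mul_sub, mul_pow, ← sq_abs (y - z), ← mul_pow] at hc
      exact div_le_div_of_nonneg_right (by linarith) (by positivity)
    rw [← Finset.mul_sum] at hterm
    have : 0 < |y - z| ^ (2 * κ - 1) := rpow_pos_of_pos hh _
    rw [← hJ] at hsum
    linarith
  have hs : Summable fun n => f (n + 1) := summable_of_sum_range_le hf0 hbound
  exact ⟨summable_pnat_iff_summable_succ.2 hs,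
    (tsum_pnat_eq_tsum_succ (f := f)).trans_le (Real.tsum_le_of_sum_range_le hf0 hbound)⟩
end

section
/- For every Hurst index H with 0 < H < 1/2 there exists a constant C = C(H) > 0 such that for every α ∈ ℕ₊, ∫₀¹∫₀¹ |φ_α(y) − φ_α(z)|² / |y − z|^{2−2H} dy dz = ∫₀¹∫₀¹ 2(sin(απy) − sin(απz))² / |y − z|^{2−2H} dy dz ≤ C λ_α^{1/2 − H} = C (απ)^{1−2H}. -/
open Real

lemma two_mul_sq_div_abs_rpow_le {p s u : ℝ} (hp₀ : 0 ≤ p) (hp₂ : p ≤ 2) (hu : s ^ 2 ≤ u ^ 2)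
    (hs : s ^ 2 ≤ 4) : 2 * s ^ 2 / |u| ^ p ≤ 8 * 2 ^ p * (1 + ‖u‖) ^ (-p) := by
  rw [Real.norm_eq_abs, Real.rpow_neg (by positivity), ← div_eq_mul_inv]
  rcases eq_or_ne u 0 with rfl | hu₀
  · have : s ^ 2 = 0 := le_antisymm (by simpa using hu) (sq_nonneg s)
    rw [this, mul_zero, zero_div]
    positivity
  have hpos : 0 < |u| := abs_pos.mpr hu₀
  rw [div_le_div_iff₀ (by positivity) (by positivity), mul_assoc 8]
  rcases le_total |u| 1 with h | h
  · have h₁ : (1 + |u|) ^ p ≤ 2 ^ p := Real.rpow_le_rpow (by positivity) (by linarith) hp₀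
    have h₂ : s ^ 2 ≤ |u| ^ p := by
      calc s ^ 2 ≤ |u| ^ (2 : ℝ) := by rw [Real.rpow_two, sq_abs]; exact hu
        _ ≤ |u| ^ p := Real.rpow_le_rpow_of_exponent_ge hpos h hp₂
    calc 2 * s ^ 2 * (1 + |u|) ^ p ≤ 8 * |u| ^ p * 2 ^ p := by gcongr; norm_num
      _ = 8 * (2 ^ p * |u| ^ p) := by ring
  · rw [← Real.mul_rpow zero_le_two hpos.le]
    have h₁ : (1 + |u|) ^ p ≤ (2 * |u|) ^ p :=
      Real.rpow_le_rpow (by positivity) (by linarith) hp₀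
    gcongr
    linarith

lemma sin_sub_sin_sq_le_sub_sq (a b : ℝ) : (sin a - sin b) ^ 2 ≤ (a - b) ^ 2 := by
  refine sq_le_sq.mpr ?_
  simpa [Real.dist_eq] using Real.lipschitzWith_sin.dist_le_mul a b

lemma sin_sub_sin_sq_le_four (a b : ℝ) : (sin a - sin b) ^ 2 ≤ 4 := by
  nlinarith [sin_sq_le_one a, sin_sq_le_one b, sq_nonneg (sin a + sin b)]

lemma integral_two_mul_sin_sub_sin_sq_div_le {p k : ℝ} (hp₁ : 1 < p) (hp₂ : p ≤ 2) (hk : 0 < k)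
    (y : ℝ) :
    ∫ z in (0 : ℝ)..1, 2 * (sin (k * y) - sin (k * z)) ^ 2 / |y - z| ^ p ≤
      8 * 2 ^ p * (∫ u : ℝ, (1 + ‖u‖) ^ (-p)) * k ^ (p - 1) := by
  have hint : MeasureTheory.Integrable fun u : ℝ ↦ (1 + ‖u‖) ^ (-p) :=
    integrable_one_add_norm (by simpa using hp₁)
  have hscale : MeasureTheory.Integrable fun z : ℝ ↦
      k ^ p * (8 * 2 ^ p * (1 + ‖k * (y - z)‖) ^ (-p)) :=
    (((hint.comp_mul_left' hk.ne').comp_sub_left y).const_mul _).const_mul _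
  have hle (z : ℝ) : 2 * (sin (k * y) - sin (k * z)) ^ 2 / |y - z| ^ p ≤
      k ^ p * (8 * 2 ^ p * (1 + ‖k * (y - z)‖) ^ (-p)) := by
    have h := two_mul_sq_div_abs_rpow_le (by linarith) hp₂
      (mul_sub k y z ▸ sin_sub_sin_sq_le_sub_sq (k * y) (k * z))
      (sin_sub_sin_sq_le_four (k * y) (k * z))
    refine le_trans (le_of_eq ?_) (mul_le_mul_of_nonneg_left h (by positivity))
    rw [abs_mul, abs_of_pos hk, Real.mul_rpow hk.le (abs_nonneg _), ← mul_div_assoc,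
      mul_div_mul_left _ _ (by positivity)]
  rw [intervalIntegral.integral_of_le zero_le_one]
  calc _ ≤ ∫ z in Set.Ioc (0 : ℝ) 1, k ^ p * (8 * 2 ^ p * (1 + ‖k * (y - z)‖) ^ (-p)) :=
        MeasureTheory.integral_mono_of_nonneg (.of_forall fun z ↦ by positivity)
          hscale.integrableOn (.of_forall hle)
    _ ≤ ∫ z, k ^ p * (8 * 2 ^ p * (1 + ‖k * (y - z)‖) ^ (-p)) :=
        MeasureTheory.setIntegral_le_integral hscale (.of_forall fun z ↦ by positivity)
    _ = _ := by
        rw [MeasureTheory.integral_const_mul, MeasureTheory.integral_const_mul,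
          MeasureTheory.integral_sub_left_eq_self (fun z ↦ (1 + ‖k * z‖) ^ (-p)),
          MeasureTheory.Measure.integral_comp_mul_left (fun u ↦ (1 + ‖u‖) ^ (-p)),
          Real.rpow_sub_one hk.ne', abs_of_pos (inv_pos.mpr hk), smul_eq_mul]
        ring

theorem stmt_4 (H : ℝ) (hH₁ : 0 < H) (hH₂ : H < 1 / 2) :
    ∃ C : ℝ, 0 < C ∧ ∀ α : ℕ+,
      (∫ y in (0:ℝ)..1, ∫ z in (0:ℝ)..1,
        2 * (Real.sin ((α : ℝ) * Real.pi * y) - Real.sin ((α : ℝ) * Real.pi * z)) ^ 2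
          / |y - z| ^ (2 - 2 * H)) ≤ C * ((α : ℝ) * Real.pi) ^ (1 - 2 * H) := by
  set p := 2 - 2 * H with hp
  have hI : 0 ≤ ∫ u : ℝ, (1 + ‖u‖) ^ (-p) :=
    MeasureTheory.integral_nonneg fun u ↦ by positivity
  refine ⟨8 * 2 ^ p * (∫ u : ℝ, (1 + ‖u‖) ^ (-p)) + 1, by positivity, fun α ↦ ?_⟩
  have hk : 0 < (α : ℝ) * π := mul_pos (by exact_mod_cast α.pos) pi_pos
  have hinner (y : ℝ) := integral_two_mul_sin_sub_sin_sq_div_le (p := p) (by linarith)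
    (by linarith) hk y
  rw [show p - 1 = 1 - 2 * H by rw [hp]; ring] at hinner
  refine (Real.le_norm_self _).trans
    ((intervalIntegral.norm_integral_le_of_norm_le_const
      (C := 8 * 2 ^ p * (∫ u : ℝ, (1 + ‖u‖) ^ (-p)) * (α * π) ^ (1 - 2 * H))
      fun y _ ↦ ?_).trans ?_)
  · rw [Real.norm_of_nonneg]
    · exact hinner y
    · exact intervalIntegral.integral_nonneg zero_le_one fun z _ ↦ by positivity
  · rw [sub_zero, abs_one, mul_one]
    gcongr
    linarith
end

section
/- For every t ≥ 0 and all real numbers y and z, ∑_{α=1}^∞ |φ_α(y) − φ_α(z)|² · ∫₀ᵗ e^{−2(απ)²(t−s)} ds, i.e. ∑_{α=1}^∞ 2(sin(απy) − sin(απz))² · (1 − e^{−2(απ)² t})/(2(απ)²), converges and is bounded above by (4/π)|y − z|. -/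
open Real

lemma HasSum.comp_pnatCast {f : ℕ → ℝ} {a : ℝ} (hf : HasSum f a) (h0 : f 0 = 0) :
    HasSum (fun n : ℕ+ => f n) a := by
  refine (PNat.coe_injective.hasSum_iff fun n hn => ?_).mpr hf
  have : n = 0 := by
    by_contra hn0
    exact hn ⟨⟨n, Nat.pos_of_ne_zero hn0⟩, rfl⟩
  rw [this, h0]

/-- The Fourier series of `x ↦ x - x ^ 2` on `[0, 1]`, written with differences `1 - cos`. -/
lemma hasSum_one_sub_cos_div_sq_s5 {x : ℝ} (hx : x ∈ Set.Icc (0 : ℝ) 1) :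
    HasSum (fun n : ℕ+ => 2 * (1 - Real.cos (2 * Real.pi * (n : ℝ) * x)) / ((n : ℝ) * Real.pi) ^ 2)
      (2 * (x - x ^ 2)) := by
  have hcos := hasSum_one_div_nat_pow_mul_cos one_ne_zero hx
  have hB : (Polynomial.map (algebraMap ℚ ℝ) (Polynomial.bernoulli (2 * 1))).eval x
      = x ^ 2 - x + 1 / 6 := by
    simp [Polynomial.bernoulli, Finset.sum_range_succ, bernoulli_two, bernoulli_one,
      bernoulli_zero]
    ring
  rw [hB] at hcos
  have h := ((hasSum_zeta_two.sub hcos).mul_left (2 / Real.pi ^ 2)).comp_pnatCast (by simp)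
  have ha : 2 / Real.pi ^ 2 * (Real.pi ^ 2 / 6 - (-1) ^ (1 + 1) * (2 * Real.pi) ^ (2 * 1) / 2 /
      ((2 * 1).factorial : ℝ) * (x ^ 2 - x + 1 / 6)) = 2 * (x - x ^ 2) := by
    norm_num [Nat.factorial]
    field_simp
    ring
  rw [ha] at h
  refine h.congr_fun fun n => ?_
  have : (n : ℝ) ≠ 0 := Nat.cast_ne_zero.2 n.ne_zero
  simp only [mul_one]
  field_simp

lemma hasSum_four_div_sq :
    HasSum (fun n : ℕ+ => 4 / ((n : ℝ) * Real.pi) ^ 2) (2 / 3) := by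
  have h := (hasSum_zeta_two.mul_left (4 / Real.pi ^ 2)).comp_pnatCast (by simp)
  have ha : 4 / Real.pi ^ 2 * (Real.pi ^ 2 / 6) = 2 / 3 := by
    field_simp
    norm_num
  rw [ha] at h
  refine h.congr_fun fun n => ?_
  have : (n : ℝ) ≠ 0 := Nat.cast_ne_zero.2 n.ne_zero
  field_simp

lemma sin_sub_sin_sq_le (a b : ℝ) :
    (Real.sin a - Real.sin b) ^ 2 ≤ 2 * (1 - Real.cos (a - b)) := by
  have ha := Real.sin_sq_add_cos_sq a
  have hb := Real.sin_sq_add_cos_sq b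
  rw [Real.cos_sub]
  nlinarith [sq_nonneg (Real.cos a - Real.cos b)]

theorem stmt_5 (t : ℝ) (ht : 0 ≤ t) (y z : ℝ) :
    Summable (fun α : ℕ+ =>
      2 * (Real.sin ((α : ℝ) * Real.pi * y) - Real.sin ((α : ℝ) * Real.pi * z)) ^ 2
        * ((1 - Real.exp (-2 * ((α : ℝ) * Real.pi) ^ 2 * t)) / (2 * ((α : ℝ) * Real.pi) ^ 2))) ∧
    ∑' α : ℕ+,
      2 * (Real.sin ((α : ℝ) * Real.pi * y) - Real.sin ((α : ℝ) * Real.pi * z)) ^ 2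
        * ((1 - Real.exp (-2 * ((α : ℝ) * Real.pi) ^ 2 * t)) / (2 * ((α : ℝ) * Real.pi) ^ 2))
      ≤ (4 / Real.pi) * |y - z| := by
  set f : ℕ+ → ℝ := fun α =>
    2 * (Real.sin ((α : ℝ) * Real.pi * y) - Real.sin ((α : ℝ) * Real.pi * z)) ^ 2
      * ((1 - Real.exp (-2 * ((α : ℝ) * Real.pi) ^ 2 * t)) / (2 * ((α : ℝ) * Real.pi) ^ 2)) with hf
  have hexp (α : ℕ+) : Real.exp (-2 * ((α : ℝ) * Real.pi) ^ 2 * t) ≤ 1 := by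
    rw [Real.exp_le_one_iff]
    have : 0 ≤ ((α : ℝ) * Real.pi) ^ 2 * t := by positivity
    linarith
  have hf0 (α : ℕ+) : 0 ≤ f α :=
    mul_nonneg (by positivity) (div_nonneg (sub_nonneg.2 (hexp α)) (by positivity))
  have hle (α : ℕ+) : f α ≤
      2 * (1 - Real.cos (2 * Real.pi * (α : ℝ) * (|y - z| / 2))) / ((α : ℝ) * Real.pi) ^ 2 := by
    have hcos : Real.cos (2 * Real.pi * (α : ℝ) * (|y - z| / 2))
        = Real.cos ((α : ℝ) * Real.pi * y - (α : ℝ) * Real.pi * z) := by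
      rw [← Real.cos_abs ((α : ℝ) * Real.pi * y - _), ← mul_sub, abs_mul,
        abs_of_pos (by positivity : 0 < (α : ℝ) * Real.pi)]
      congr 1
      ring
    have hα : (α : ℝ) ≠ 0 := by positivity
    calc f α = (Real.sin ((α : ℝ) * Real.pi * y) - Real.sin ((α : ℝ) * Real.pi * z)) ^ 2
          * (1 - Real.exp (-2 * ((α : ℝ) * Real.pi) ^ 2 * t)) / ((α : ℝ) * Real.pi) ^ 2 := by
          simp only [hf]
          field_simp
      _ ≤ _ := by
          rw [hcos]
          refine div_le_div_of_nonneg_right ?_ (by positivity)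
          refine (mul_le_of_le_one_right (sq_nonneg _) ?_).trans (sin_sub_sin_sq_le _ _)
          linarith [Real.exp_pos (-2 * ((α : ℝ) * Real.pi) ^ 2 * t)]
  have hle' (α : ℕ+) : f α ≤ 4 / ((α : ℝ) * Real.pi) ^ 2 := by
    refine (hle α).trans ?_
    gcongr
    linarith [Real.neg_one_le_cos (2 * Real.pi * (α : ℝ) * (|y - z| / 2))]
  have hsum : Summable f := .of_nonneg_of_le hf0 hle' hasSum_four_div_sq.summable
  refine ⟨hsum, ?_⟩
  have hpi : 1 ≤ 4 / Real.pi := by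
    rw [one_le_div Real.pi_pos]
    exact Real.pi_le_four
  refine le_trans ?_ (le_mul_of_one_le_left (abs_nonneg (y - z)) hpi)
  rcases le_total (|y - z|) 2 with hd | hd
  · have hx : |y - z| / 2 ∈ Set.Icc (0 : ℝ) 1 := ⟨by positivity, by linarith⟩
    have := hasSum_le hle hsum.hasSum (hasSum_one_sub_cos_div_sq_s5 hx)
    nlinarith [sq_nonneg (|y - z| / 2)]
  · linarith [hasSum_le hle' hsum.hasSum hasSum_four_div_sq]
end

section
/- For every T > 0 there exists a constant C = C(T) > 0 (one may take C = 8T/π) such that for every t ∈ [0,T] and all real numbers y and z, ∑_{α=1}^∞ |φ_α(y) − φ_α(z)|² · ∫₀ᵗ (sin(απ(t−s))/(απ))² ds, i.e. ∑_{α=1}^∞ 2(sin(απy) − sin(απz))² · ∫₀ᵗ sin²(απ(t−s))/(απ)² ds, converges and is bounded above by C|y − z|. -/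
theorem sq_sin_sub_sin_div_sq_le (n : ℕ) (y z : ℝ) :
    (Real.sin (((n + 1 : ℕ) : ℝ) * Real.pi * y) - Real.sin (((n + 1 : ℕ) : ℝ) * Real.pi * z)) ^ 2
        / (((n + 1 : ℕ) : ℝ) * Real.pi) ^ 2
      ≤ 4 * (|y - z| / (1 + n * |y - z|) - |y - z| / (1 + (n + 1 : ℕ) * |y - z|)) := by
  have hlip := Real.abs_sin_sub_sin_le (((n + 1 : ℕ) : ℝ) * Real.pi * y)
    (((n + 1 : ℕ) : ℝ) * Real.pi * z)
  rw [← mul_sub, abs_mul, abs_of_pos (by positivity : 0 < ((n + 1 : ℕ) : ℝ) * Real.pi)] at hlip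
  have hbdd : |Real.sin (((n + 1 : ℕ) : ℝ) * Real.pi * y)
      - Real.sin (((n + 1 : ℕ) : ℝ) * Real.pi * z)| ≤ 2 := by
    rw [abs_le]
    constructor <;>
    linarith [Real.neg_one_le_sin (((n + 1 : ℕ) : ℝ) * Real.pi * y),
      Real.neg_one_le_sin (((n + 1 : ℕ) : ℝ) * Real.pi * z),
      Real.sin_le_one (((n + 1 : ℕ) : ℝ) * Real.pi * y),
      Real.sin_le_one (((n + 1 : ℕ) : ℝ) * Real.pi * z)]
  rw [← sq_abs]
  have hD := abs_nonneg (Real.sin (((n + 1 : ℕ) : ℝ) * Real.pi * y)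
    - Real.sin (((n + 1 : ℕ) : ℝ) * Real.pi * z))
  generalize |Real.sin (((n + 1 : ℕ) : ℝ) * Real.pi * y)
    - Real.sin (((n + 1 : ℕ) : ℝ) * Real.pi * z)| = D at *
  have hh : 0 ≤ |y - z| := abs_nonneg _
  generalize |y - z| = h at *
  push_cast at *
  have hn : (0 : ℝ) ≤ n := Nat.cast_nonneg n
  generalize (n : ℝ) = x at *
  have hdiff : h / (1 + x * h) - h / (1 + (x + 1) * h)
      = h ^ 2 / ((1 + x * h) * (1 + (x + 1) * h)) := by
    field_simp
    ring
  have hP : (1 + x * h) * (1 + (x + 1) * h) ≤ (1 + (x + 1) * h) ^ 2 := by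
    nlinarith [mul_nonneg hn hh, mul_nonneg hh hh]
  have hpi := Real.pi_gt_three
  rw [hdiff, ← mul_div_assoc, div_le_div_iff₀ (by positivity) (by positivity)]
  rcases le_total ((x + 1) * h) 1 with hs | hs
  · have h1 : (1 + (x + 1) * h) ^ 2 ≤ 4 := by
      nlinarith [mul_nonneg (by linarith : 0 ≤ x + 1) hh]
    calc D ^ 2 * ((1 + x * h) * (1 + (x + 1) * h))
        ≤ ((x + 1) * Real.pi * h) ^ 2 * 4 := by gcongr; exact hP.trans h1
      _ = 4 * h ^ 2 * ((x + 1) * Real.pi) ^ 2 := by ring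
  · have h1 : (1 + (x + 1) * h) ^ 2 ≤ (2 * ((x + 1) * h)) ^ 2 := by gcongr; linarith
    calc D ^ 2 * ((1 + x * h) * (1 + (x + 1) * h))
        ≤ Real.pi ^ 2 * (2 * ((x + 1) * h)) ^ 2 := by
          gcongr
          · linarith
          · exact hP.trans h1
      _ = 4 * h ^ 2 * ((x + 1) * Real.pi) ^ 2 := by ring

theorem integral_sq_sin_div_sq_mem_Icc {t T a : ℝ} (ht : t ∈ Set.Icc 0 T) :
    (∫ s in (0:ℝ)..t, (Real.sin (a * (t - s))) ^ 2 / a ^ 2) ∈ Set.Icc 0 (T / a ^ 2) := by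
  constructor
  · exact intervalIntegral.integral_nonneg ht.1 fun s _ => by positivity
  · calc (∫ s in (0:ℝ)..t, (Real.sin (a * (t - s))) ^ 2 / a ^ 2)
        ≤ ∫ _ in (0:ℝ)..t, 1 / a ^ 2 := by
          refine intervalIntegral.integral_mono_on ht.1 ?_ ?_ fun s _ => ?_
          · exact Continuous.intervalIntegrable (by fun_prop) _ _
          · exact Continuous.intervalIntegrable (by fun_prop) _ _
          · gcongr
            exact Real.sin_sq_le_one _
      _ = t / a ^ 2 := by simp [div_eq_mul_inv]
      _ ≤ T / a ^ 2 := by gcongr; exact ht.2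

theorem stmt_6 (T : ℝ) (hT : 0 < T) :
    ∃ C : ℝ, 0 < C ∧ ∀ t ∈ Set.Icc (0:ℝ) T, ∀ y z : ℝ,
      Summable (fun α : ℕ+ =>
        2 * (Real.sin ((α : ℝ) * Real.pi * y) - Real.sin ((α : ℝ) * Real.pi * z)) ^ 2
          * (∫ s in (0:ℝ)..t,
              (Real.sin ((α : ℝ) * Real.pi * (t - s))) ^ 2 / ((α : ℝ) * Real.pi) ^ 2)) ∧
      ∑' α : ℕ+,
        2 * (Real.sin ((α : ℝ) * Real.pi * y) - Real.sin ((α : ℝ) * Real.pi * z)) ^ 2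
          * (∫ s in (0:ℝ)..t,
              (Real.sin ((α : ℝ) * Real.pi * (t - s))) ^ 2 / ((α : ℝ) * Real.pi) ^ 2)
        ≤ C * |y - z| := by
  refine ⟨8 * T, by positivity, fun t ht y z => ?_⟩
  let f : ℕ → ℝ := fun n =>
    2 * (Real.sin ((n : ℝ) * Real.pi * y) - Real.sin ((n : ℝ) * Real.pi * z)) ^ 2
      * (∫ s in (0:ℝ)..t, (Real.sin ((n : ℝ) * Real.pi * (t - s))) ^ 2 / ((n : ℝ) * Real.pi) ^ 2)
  have hI (n : ℕ) := integral_sq_sin_div_sq_mem_Icc (a := (n : ℝ) * Real.pi) ht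
  have hf (n : ℕ) : 0 ≤ f n := mul_nonneg (by positivity) (hI n).1
  have hsum (N : ℕ) : ∑ n ∈ Finset.range N, f (n + 1) ≤ 8 * T * |y - z| := by
    calc ∑ n ∈ Finset.range N, f (n + 1)
        ≤ ∑ n ∈ Finset.range N, 8 * T *
            (|y - z| / (1 + n * |y - z|) - |y - z| / (1 + (n + 1 : ℕ) * |y - z|)) := by
          refine Finset.sum_le_sum fun n _ => ?_
          have h1 := mul_le_mul_of_nonneg_left (sq_sin_sub_sin_div_sq_le n y z)
            (by positivity : 0 ≤ 2 * T)
          refine (mul_le_mul_of_nonneg_left (hI (n + 1)).2 (by positivity)).trans ?_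
          refine (le_of_eq ?_).trans (h1.trans (le_of_eq ?_)) <;> ring
      _ = 8 * T * (|y - z| - |y - z| / (1 + N * |y - z|)) := by
          rw [← Finset.mul_sum,
            Finset.sum_range_sub' (fun n : ℕ => |y - z| / (1 + n * |y - z|))]
          simp
      _ ≤ 8 * T * |y - z| := by
          gcongr
          exact sub_le_self _ (by positivity)
  refine ⟨(summable_pnat_iff_summable_succ (f := f)).2
    (summable_of_sum_range_le (fun n => hf (n + 1)) hsum), ?_⟩
  exact (tsum_pnat_eq_tsum_succ (f := f)).trans_le
    (Real.tsum_le_of_sum_range_le (fun n => hf (n + 1)) hsum)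
end

section
/- For every t ≥ 0 and all real numbers y and z, ∑_{α=1}^∞ |ψ_α(y) − ψ_α(z)|² · ∫₀ᵗ e^{−2(απ)²(t−s)} ds, i.e. ∑_{α=1}^∞ 2(cos(απy) − cos(απz))² · (1 − e^{−2(απ)² t})/(2(απ)²), converges and is bounded above by (4/π)|y − z|. -/
open Real

/-- The primitive of `x ↦ min 1 (c² / x²)` vanishing at `0`. -/
noncomputable def minPrimitive (c x : ℝ) : ℝ :=
  if x ≤ c then x else 2 * c - c ^ 2 / x

lemma minPrimitive_le {c x : ℝ} (hc : 0 < c) : minPrimitive c x ≤ 2 * c := by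
  unfold minPrimitive
  split_ifs with h
  · linarith
  · have : 0 < x := hc.trans (not_le.mp h)
    have : 0 ≤ c ^ 2 / x := by positivity
    linarith

lemma min_le_minPrimitive_sub {c x : ℝ} (hc : 0 < c) (hx : 0 ≤ x) :
    min 1 (c ^ 2 / (x + 1) ^ 2) ≤ minPrimitive c (x + 1) - minPrimitive c x := by
  have h1 : 0 < x + 1 := by linarith
  unfold minPrimitive
  split_ifs with h h' h'
  · linarith [min_le_left 1 (c ^ 2 / (x + 1) ^ 2)]
  · linarith
  · refine (min_le_right _ _).trans ?_
    push Not at h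
    have key : 2 * c - c ^ 2 / (x + 1) - x - c ^ 2 / (x + 1) ^ 2
        = ((c - x) * ((x + 1) ^ 2 - c ^ 2) + c * (x + 1 - c) * (x + 1 - c)) / (x + 1) ^ 2 := by
      field_simp
      ring
    have : 0 ≤ ((c - x) * ((x + 1) ^ 2 - c ^ 2) + c * (x + 1 - c) * (x + 1 - c))
        / (x + 1) ^ 2 := by
      have ha : 0 ≤ c - x := by linarith
      have hb : 0 ≤ x + 1 - c := by linarith
      have hd : 0 ≤ (x + 1) ^ 2 - c ^ 2 := by nlinarith
      positivity
    linarith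
  · refine (min_le_right _ _).trans ?_
    push Not at h'
    have hx0 : 0 < x := hc.trans h'
    have key : 2 * c - c ^ 2 / (x + 1) - (2 * c - c ^ 2 / x) - c ^ 2 / (x + 1) ^ 2
        = c ^ 2 / (x * (x + 1) ^ 2) := by
      field_simp
      ring
    have : 0 ≤ c ^ 2 / (x * (x + 1) ^ 2) := by positivity
    linarith

lemma sum_range_min_one_div_sq_le {c : ℝ} (hc : 0 < c) (n : ℕ) :
    ∑ i ∈ Finset.range n, min 1 (c ^ 2 / ((i : ℝ) + 1) ^ 2) ≤ 2 * c := by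
  calc ∑ i ∈ Finset.range n, min 1 (c ^ 2 / ((i : ℝ) + 1) ^ 2)
      ≤ ∑ i ∈ Finset.range n, (minPrimitive c ((i + 1 : ℕ) : ℝ) - minPrimitive c (i : ℝ)) := by
        refine Finset.sum_le_sum fun i _ => ?_
        push_cast
        exact min_le_minPrimitive_sub hc i.cast_nonneg
    _ = minPrimitive c n - minPrimitive c (0 : ℕ) :=
        Finset.sum_range_sub (fun i : ℕ => minPrimitive c i) n
    _ ≤ 2 * c := by
        have : minPrimitive c (0 : ℕ) = 0 := by simp [minPrimitive, hc.le]
        linarith [minPrimitive_le (x := n) hc]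

lemma cos_sub_cos_sq_div_le {m y z : ℝ} (hm : 0 < m) (hyz : y ≠ z) :
    (cos (m * π * y) - cos (m * π * z)) ^ 2 / (m * π) ^ 2
      ≤ (y - z) ^ 2 * min 1 ((2 / (π * |y - z|)) ^ 2 / m ^ 2) := by
  have hd : 0 < |y - z| := abs_pos.mpr (sub_ne_zero.mpr hyz)
  have hπ := Real.pi_pos
  rw [← sq_abs (y - z), mul_min_of_nonneg _ _ (sq_nonneg _), le_min_iff]
  constructor
  · rw [div_le_iff₀ (by positivity), mul_one, ← mul_pow, ← sq_abs (_ - _)]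
    refine pow_le_pow_left₀ (abs_nonneg _) ((abs_cos_sub_cos_le _ _).trans_eq ?_) 2
    rw [← mul_sub, abs_mul, abs_of_pos (by positivity : 0 < m * π), mul_comm]
  · have h : |y - z| ^ 2 * ((2 / (π * |y - z|)) ^ 2 / m ^ 2) = 4 / (m * π) ^ 2 := by
      field_simp
      norm_num
    rw [h]
    gcongr
    nlinarith [neg_one_le_cos (m * π * y), cos_le_one (m * π * y),
      neg_one_le_cos (m * π * z), cos_le_one (m * π * z)]

theorem stmt_7 (t : ℝ) (ht : 0 ≤ t) (y z : ℝ) :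
    Summable (fun α : ℕ+ =>
      2 * (Real.cos ((α : ℝ) * Real.pi * y) - Real.cos ((α : ℝ) * Real.pi * z)) ^ 2
        * ((1 - Real.exp (-2 * ((α : ℝ) * Real.pi) ^ 2 * t)) / (2 * ((α : ℝ) * Real.pi) ^ 2))) ∧
    ∑' α : ℕ+,
      2 * (Real.cos ((α : ℝ) * Real.pi * y) - Real.cos ((α : ℝ) * Real.pi * z)) ^ 2
        * ((1 - Real.exp (-2 * ((α : ℝ) * Real.pi) ^ 2 * t)) / (2 * ((α : ℝ) * Real.pi) ^ 2))
      ≤ (4 / Real.pi) * |y - z| := by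
  rcases eq_or_ne y z with rfl | hyz
  · simp [summable_zero]
  let f : ℕ → ℝ := fun n =>
    2 * (Real.cos ((n : ℝ) * Real.pi * y) - Real.cos ((n : ℝ) * Real.pi * z)) ^ 2
      * ((1 - Real.exp (-2 * ((n : ℝ) * Real.pi) ^ 2 * t)) / (2 * ((n : ℝ) * Real.pi) ^ 2))
  have hd : 0 < |y - z| := abs_pos.mpr (sub_ne_zero.mpr hyz)
  have hπ := Real.pi_pos
  have hf0 (n : ℕ) : 0 ≤ f n := by
    have : Real.exp (-2 * ((n : ℝ) * Real.pi) ^ 2 * t) ≤ 1 := by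
      rw [Real.exp_le_one_iff]
      have : 0 ≤ ((n : ℝ) * Real.pi) ^ 2 * t := by positivity
      linarith
    have : 0 ≤ 1 - Real.exp (-2 * ((n : ℝ) * Real.pi) ^ 2 * t) := by linarith
    positivity
  have hf (n : ℕ) : f n ≤ (cos (n * π * y) - cos (n * π * z)) ^ 2 / (n * π) ^ 2 := by
    have h : f n = (cos (n * π * y) - cos (n * π * z)) ^ 2 / (n * π) ^ 2
        * (1 - Real.exp (-2 * ((n : ℝ) * Real.pi) ^ 2 * t)) := by
      simp only [f]
      ring
    rw [h]
    exact mul_le_of_le_one_right (by positivity) (sub_le_self _ (Real.exp_pos _).le)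
  have hsum (N : ℕ) : ∑ i ∈ Finset.range N, f (i + 1) ≤ 4 / π * |y - z| := by
    calc ∑ i ∈ Finset.range N, f (i + 1)
        ≤ ∑ i ∈ Finset.range N,
            (y - z) ^ 2 * min 1 ((2 / (π * |y - z|)) ^ 2 / ((i : ℝ) + 1) ^ 2) := by
          refine Finset.sum_le_sum fun i _ => (hf (i + 1)).trans ?_
          push_cast
          exact cos_sub_cos_sq_div_le (by positivity) hyz
      _ ≤ (y - z) ^ 2 * (2 * (2 / (π * |y - z|))) := by
          rw [← Finset.mul_sum]
          exact mul_le_mul_of_nonneg_left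
            (sum_range_min_one_div_sq_le (by positivity) N) (sq_nonneg _)
      _ = 4 / π * |y - z| := by
          rw [← sq_abs (y - z)]
          field_simp
          norm_num
  refine ⟨(summable_pnat_iff_summable_succ (f := f)).mpr
    (summable_of_sum_range_le (fun i => hf0 (i + 1)) hsum), ?_⟩
  exact (tsum_pnat_eq_tsum_succ (f := f)).trans_le
    (Real.tsum_le_of_sum_range_le (fun i => hf0 (i + 1)) hsum)
end

section
/- For every t ≥ 0, the series ∑_{α=1}^∞ (1 − e^{−2(απ)² t}) / (2(απ)²) converges and is bounded above by √(t/(2π)). -/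
open Real

/-- A sum of values of a Gaussian at positive integers is at most its integral over `(0, ∞)`. -/
theorem sum_exp_neg_mul_sq_le {b : ℝ} (hb : 0 < b) (N : ℕ) :
    ∑ i ∈ Finset.range N, Real.exp (-b * ((i : ℝ) + 1) ^ 2) ≤ Real.sqrt (Real.pi / b) / 2 := by
  have hanti : AntitoneOn (fun x : ℝ => Real.exp (-b * x ^ 2)) (Set.Icc 0 (0 + (N : ℝ))) := by
    intro x hx y _ hxy
    have h : x ^ 2 ≤ y ^ 2 := pow_le_pow_left₀ hx.1 hxy 2
    exact Real.exp_le_exp.2 (by nlinarith)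
  have hsum := hanti.sum_le_integral
  simp only [zero_add] at hsum
  calc _ = ∑ i ∈ Finset.range N, Real.exp (-b * ((i + 1 : ℕ) : ℝ) ^ 2) := by push_cast; rfl
    _ ≤ ∫ x in (0 : ℝ)..N, Real.exp (-b * x ^ 2) := hsum
    _ = ∫ x in Set.Ioc (0 : ℝ) N, Real.exp (-b * x ^ 2) :=
        intervalIntegral.integral_of_le N.cast_nonneg
    _ ≤ ∫ x in Set.Ioi (0 : ℝ), Real.exp (-b * x ^ 2) :=
        MeasureTheory.setIntegral_mono_set (integrable_exp_neg_mul_sq hb).integrableOn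
          (Filter.Eventually.of_forall fun x => (Real.exp_pos _).le)
          Set.Ioc_subset_Ioi_self.eventuallyLE
    _ = _ := integral_gaussian_Ioi b

/-- Both sides vanish at `t = 0`, and the derivative of the left side is dominated by that of the
right side by `sum_exp_neg_mul_sq_le`. -/
theorem sum_heat_term_le {t : ℝ} (ht : 0 ≤ t) (N : ℕ) :
    ∑ i ∈ Finset.range N, (1 - Real.exp (-2 * (((i : ℝ) + 1) * Real.pi) ^ 2 * t)) /
      (2 * (((i : ℝ) + 1) * Real.pi) ^ 2) ≤ Real.sqrt (t / (2 * Real.pi)) := by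
  have hpi := Real.pi_pos
  let g : ℝ → ℝ := fun s => Real.sqrt (s / (2 * Real.pi)) -
    ∑ i ∈ Finset.range N, (1 - Real.exp (-2 * (((i : ℝ) + 1) * Real.pi) ^ 2 * s)) /
      (2 * (((i : ℝ) + 1) * Real.pi) ^ 2)
  have hderiv : ∀ s : ℝ, 0 < s → HasDerivAt g (1 / (2 * Real.pi) /
      (2 * Real.sqrt (s / (2 * Real.pi))) -
      ∑ i ∈ Finset.range N, Real.exp (-(2 * Real.pi ^ 2 * s) * ((i : ℝ) + 1) ^ 2)) s := by
    intro s hs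
    refine (((hasDerivAt_id s).div_const _).sqrt (by simp; positivity)).sub
      (HasDerivAt.fun_sum fun i _ => ?_)
    have h := (((((hasDerivAt_id s).const_mul
      (-2 * (((i : ℝ) + 1) * Real.pi) ^ 2)).exp).const_sub 1).div_const
      (2 * (((i : ℝ) + 1) * Real.pi) ^ 2))
    refine h.congr_deriv ?_
    have hi : (i : ℝ) + 1 ≠ 0 := by positivity
    have he : -2 * (((i : ℝ) + 1) * Real.pi) ^ 2 * id s =
        -(2 * Real.pi ^ 2 * s) * ((i : ℝ) + 1) ^ 2 := by simp only [id]; ring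
    rw [he]
    field_simp
  have hmono : MonotoneOn g (Set.Ici 0) := by
    refine monotoneOn_of_deriv_nonneg (convex_Ici 0) (by fun_prop) ?_ ?_ <;>
      rw [interior_Ici]
    · exact fun s hs => (hderiv s hs).differentiableAt.differentiableWithinAt
    · intro s hs
      have hs' : 0 < s := hs
      rw [(hderiv s hs).deriv, sub_nonneg]
      refine (sum_exp_neg_mul_sq_le (by positivity) N).trans_eq ?_
      have hq : 0 < s / (2 * Real.pi) := by positivity
      have hr : Real.pi / (2 * Real.pi ^ 2 * s) =
          ((1 / (2 * Real.pi)) / Real.sqrt (s / (2 * Real.pi))) ^ 2 := by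
        rw [div_pow, Real.sq_sqrt hq.le]
        field_simp
      rw [hr, Real.sqrt_sq (by positivity)]
      field_simp
  have h := hmono Set.self_mem_Ici ht ht
  simpa [g] using h

theorem stmt_11 (t : ℝ) (ht : 0 ≤ t) :
    Summable (fun α : ℕ+ =>
      (1 - Real.exp (-2 * ((α : ℝ) * Real.pi) ^ 2 * t)) / (2 * ((α : ℝ) * Real.pi) ^ 2)) ∧
    ∑' α : ℕ+,
      (1 - Real.exp (-2 * ((α : ℝ) * Real.pi) ^ 2 * t)) / (2 * ((α : ℝ) * Real.pi) ^ 2)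
    ≤ Real.sqrt (t / (2 * Real.pi)) := by
  let f : ℕ → ℝ := fun n =>
    (1 - Real.exp (-2 * ((n : ℝ) * Real.pi) ^ 2 * t)) / (2 * ((n : ℝ) * Real.pi) ^ 2)
  have hf : ∀ n, 0 ≤ f (n + 1) := fun n =>
    div_nonneg (sub_nonneg.2 (Real.exp_le_one_iff.2 (by
      have : 0 ≤ (((n + 1 : ℕ) : ℝ) * Real.pi) ^ 2 * t := by positivity
      linarith))) (by positivity)
  have hle : ∀ N, ∑ i ∈ Finset.range N, f (i + 1) ≤ Real.sqrt (t / (2 * Real.pi)) := fun N => by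
    simpa [f] using sum_heat_term_le ht N
  refine ⟨(summable_pnat_iff_summable_succ (f := f)).2 (summable_of_sum_range_le hf hle), ?_⟩
  exact (tsum_pnat_eq_tsum_succ (f := f)).trans_le (Real.tsum_le_of_sum_range_le hf hle)
end

section
/- For every r ≥ 0, the series ∑_{α=1}^∞ min(8, 2(απ)² r²) / (απ)² converges and is bounded above by (8/π) r. -/
open Real

theorem sum_range_min_div_sq_le (t : ℝ) (n : ℕ) :
    ∑ i ∈ Finset.range n, min 8 (2 * ((i : ℝ) + 1) ^ 2 * t ^ 2) / ((i : ℝ) + 1) ^ 2 ≤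
        2 * t ^ 2 * n ∧
      (2 ≤ t * n →
        ∑ i ∈ Finset.range n, min 8 (2 * ((i : ℝ) + 1) ^ 2 * t ^ 2) / ((i : ℝ) + 1) ^ 2 ≤
          8 * t - 8 / n) := by
  induction n with
  | zero => norm_num
  | succ n ih =>
    obtain ⟨ih₁, ih₂⟩ := ih
    rw [Finset.sum_range_succ]
    push_cast
    have hn : (0 : ℝ) ≤ n := n.cast_nonneg
    have hquad : min 8 (2 * ((n : ℝ) + 1) ^ 2 * t ^ 2) / ((n : ℝ) + 1) ^ 2 ≤ 2 * t ^ 2 := by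
      rw [div_le_iff₀ (by positivity)]
      exact (min_le_right _ _).trans_eq (by ring)
    have hconst : min 8 (2 * ((n : ℝ) + 1) ^ 2 * t ^ 2) / ((n : ℝ) + 1) ^ 2 ≤
        8 / ((n : ℝ) + 1) ^ 2 := by
      gcongr
      exact min_le_left _ _
    refine ⟨by linarith, fun h => ?_⟩
    rcases le_or_gt 2 (t * n) with h' | h'
    · have hpos : (0 : ℝ) < n := by
        rcases hn.eq_or_lt with h0 | h0
        · rw [← h0] at h'
          norm_num at h'
        · exact h0
      have hstep : 8 / ((n : ℝ) + 1) ^ 2 + 8 / ((n : ℝ) + 1) ≤ 8 / n := by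
        rw [div_add_div _ _ (by positivity) (by positivity),
          div_le_div_iff₀ (by positivity) hpos]
        ring_nf
        nlinarith [mul_pos hpos hpos]
      linarith [ih₂ h']
    · have hstep : 8 / ((n : ℝ) + 1) ^ 2 + 8 / ((n : ℝ) + 1) ≤ 8 * t - 2 * t ^ 2 * n := by
        have hm : (0 : ℝ) < (n : ℝ) + 1 := by positivity
        have heq : 8 / ((n : ℝ) + 1) ^ 2 + 8 / ((n : ℝ) + 1) =
            (8 + 8 * ((n : ℝ) + 1)) / ((n : ℝ) + 1) ^ 2 := by
          field_simp
        rw [heq, div_le_iff₀ (by positivity)]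
        have h₁ : 0 ≤ t * ((n : ℝ) + 1) - 2 := by linarith
        have h₂ : 0 ≤ 4 - n * (t * ((n : ℝ) + 1) - 2) := by nlinarith
        nlinarith [mul_nonneg h₁ h₂]
      linarith

theorem sum_range_min_div_sq_le_eight_mul {t : ℝ} (ht : 0 ≤ t) (n : ℕ) :
    ∑ i ∈ Finset.range n, min 8 (2 * ((i : ℝ) + 1) ^ 2 * t ^ 2) / ((i : ℝ) + 1) ^ 2 ≤
      8 * t := by
  obtain ⟨h₁, h₂⟩ := sum_range_min_div_sq_le t n
  rcases le_or_gt 2 (t * n) with h | h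
  · have : (0 : ℝ) ≤ 8 / n := by positivity
    linarith [h₂ h]
  · nlinarith

theorem stmt_19 (r : ℝ) (hr : 0 ≤ r) :
    Summable (fun α : ℕ+ =>
      min 8 (2 * ((α : ℝ) * Real.pi) ^ 2 * r ^ 2) / ((α : ℝ) * Real.pi) ^ 2) ∧
    ∑' α : ℕ+, min 8 (2 * ((α : ℝ) * Real.pi) ^ 2 * r ^ 2) / ((α : ℝ) * Real.pi) ^ 2
    ≤ (8 / Real.pi) * r := by
  set f : ℕ → ℝ := fun n =>
    min 8 (2 * ((n : ℝ) * Real.pi) ^ 2 * r ^ 2) / ((n : ℝ) * Real.pi) ^ 2 with hf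
  have hnonneg (n : ℕ) : 0 ≤ f (n + 1) := by
    simp only [hf]
    positivity
  have hsum (n : ℕ) : ∑ i ∈ Finset.range n, f (i + 1) ≤ 8 / π * r := by
    have hterm (i : ℕ) : f (i + 1) =
        min 8 (2 * ((i : ℝ) + 1) ^ 2 * (r * π) ^ 2) / ((i : ℝ) + 1) ^ 2 / π ^ 2 := by
      simp only [hf]
      push_cast
      rw [div_div, mul_pow, mul_pow]
      congr 2
      ring
    simp only [hterm, ← Finset.sum_div]
    rw [div_le_iff₀ (by positivity)]
    refine (sum_range_min_div_sq_le_eight_mul (by positivity) n).trans_eq ?_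
    field_simp
  have hsummable : Summable fun n => f (n + 1) := summable_of_sum_range_le hnonneg hsum
  refine ⟨(summable_pnat_iff_summable_succ (f := f)).2 hsummable, ?_⟩
  exact (tsum_pnat_eq_tsum_succ (f := f)).trans_le (Real.tsum_le_of_sum_range_le hnonneg hsum)
end
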